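/- Terminating q-Dixon formula: for every natural number m, nonzero parameters x, M, and q, the terminating basic hypergeometric sum \sum_{k=0}^{m} \frac{(x^2;q)_k (-qx;q)_k (q^{-m};q)_k (M;q)_k}{(q;q)_k (-x;q)_k (q^{1+m}x^2;q)_k (qx^2/M;q)_k} \left(\frac{q^{1+m}x}{M}\right)^k = \frac{(qx^2;q)_m (qx/M;q)_m}{(qx;q)_m (qx^2/M;q)_m}, as an identity of rational functions in q, x, M. -/

import Mathlib

/-- The q-shifted factorial `(a;q)_n = ∏_{j=0}^{n-1} (1 - a q^j)`. -/
noncomputable def qPoch {F : Type*} [Field F] (a q : F) (n : ℕ) : F :=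
  ∏ j ∈ Finset.range n, (1 - a * q ^ j)

lemma qPoch_zero' {F : Type*} [Field F] (a q : F) : qPoch a q 0 = 1 := by
  simp [qPoch]

lemma qPoch_succ_right {F : Type*} [Field F] (a q : F) (n : ℕ) :
    qPoch a q (n + 1) = qPoch a q n * (1 - a * q ^ n) := by
  simp [qPoch, Finset.prod_range_succ]

lemma qPoch_succ_left {F : Type*} [Field F] (a q : F) (n : ℕ) :
    qPoch a q (n + 1) = (1 - a) * qPoch (q * a) q n := by
  simp only [qPoch, Finset.prod_range_succ', pow_zero, mul_one]
  rw [mul_comm]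
  congr 1
  refine Finset.prod_congr rfl fun j _ => ?_
  ring

lemma qPoch_ne_zero' {F : Type*} [Field F] (a q : F) (n : ℕ)
    (h : ∀ j : ℕ, 1 - a * q ^ j ≠ 0) : qPoch a q n ≠ 0 :=
  Finset.prod_ne_zero_iff.mpr fun j _ => h j

/-- The ratio `(-qx;q)_k / (-x;q)_k`. -/
lemma qPoch_neg_ratio {F : Type*} [Field F] (x q : F) (k : ℕ) :
    qPoch (-(q * x)) q k * (1 + x) = qPoch (-x) q k * (1 + x * q ^ k) := by
  have h1 := qPoch_succ_left (-x) q k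
  have h2 := qPoch_succ_right (-x) q k
  rw [h2, mul_neg] at h1
  linear_combination -h1

/-- The summand. -/
noncomputable def dixT {F : Type*} [Field F] (q x M N : F) (k : ℕ) : F :=
  (qPoch (x ^ 2) q k * qPoch (-(q * x)) q k * qPoch N⁻¹ q k * qPoch M q k) /
    (qPoch q q k * qPoch (-x) q k * qPoch (q * N * x ^ 2) q k * qPoch (q * x ^ 2 / M) q k) *
    (q * N * x / M) ^ k

/-- The scaled shifted summand. -/
noncomputable def dixU {F : Type*} [Field F] (q x M N : F) (k : ℕ) : F :=
  qPoch (q * x ^ 2) q (k + 1) * (1 + x * q * q ^ k) * qPoch (q * N⁻¹) q k * qPoch M q k *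
    ((1 - q * x / M) * (1 - q * N * x ^ 2 / M)) /
    (qPoch q q k * qPoch (q * N * x ^ 2) q (k + 1) * qPoch (q * x ^ 2 / M) q (k + 2)) *
    (q * N * x / M) ^ k

/-- The telescoping certificate. -/
noncomputable def dixG {F : Type*} [Field F] (q x M N : F) (k : ℕ) : F :=
  (1 + N * x - x - q * N * x / M * x
      - x ^ 2 * (q * N * x / M + 1 - q * x / M - q * N * x / M * x) * q ^ (k + 1)) / N *
    (qPoch (q * x ^ 2) q k * qPoch (q * N⁻¹) q k * qPoch M q (k + 1)) /
    (qPoch q q k * qPoch (q * N * x ^ 2) q (k + 1) * qPoch (q * x ^ 2 / M) q (k + 2)) *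
    (q * N * x / M) ^ (k + 1)

lemma dix_tele {F : Type*} [Field F] (q x M N : F)
    (hN : N ≠ 0) (hM : M ≠ 0)
    (hqq : ∀ j : ℕ, 1 - q * q ^ j ≠ 0)
    (hnegx : ∀ j : ℕ, 1 + x * q ^ j ≠ 0)
    (hx2 : ∀ j : ℕ, 1 - q * N * x ^ 2 * q ^ j ≠ 0)
    (hMx : ∀ j : ℕ, 1 - q * x ^ 2 / M * q ^ j ≠ 0) (n : ℕ) :
    ∑ k ∈ Finset.range (n + 1), (dixT q x M N k - dixU q x M N k) = dixG q x M N n := by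
  have key : ∀ k, dixT q x M N k = qPoch (x ^ 2) q k * (1 + x * q ^ k) / (1 + x) *
      qPoch N⁻¹ q k * qPoch M q k /
      (qPoch q q k * qPoch (q * N * x ^ 2) q k * qPoch (q * x ^ 2 / M) q k) *
      (q * N * x / M) ^ k := by
    intro k
    have h0 : (1 + x) ≠ 0 := by simpa using hnegx 0
    have h1 := qPoch_neg_ratio x q k
    have h2 : qPoch (-x) q k ≠ 0 := qPoch_ne_zero' _ _ _ (by intro j; simpa using hnegx j)
    have h3 : qPoch (-(q * x)) q k = qPoch (-x) q k * (1 + x * q ^ k) / (1 + x) := by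
      rw [eq_div_iff h0, h1]
    rw [dixT, h3]
    congr 1
    rw [div_eq_div_iff]
    · ring
    · exact mul_ne_zero (mul_ne_zero (mul_ne_zero (qPoch_ne_zero' _ _ _ hqq) h2)
        (qPoch_ne_zero' _ _ _ hx2)) (qPoch_ne_zero' _ _ _ hMx)
    · exact mul_ne_zero (mul_ne_zero (qPoch_ne_zero' _ _ _ hqq)
        (qPoch_ne_zero' _ _ _ hx2)) (qPoch_ne_zero' _ _ _ hMx)
  have hx0 : (1 + x) ≠ 0 := by simpa using hnegx 0
  induction n with
  | zero =>
    have a1 := hx2 0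
    have a2 := hMx 0
    have a3 := hMx 1
    simp only [zero_add, Finset.sum_range_one, key, dixU, dixG, qPoch_succ_right, qPoch_zero',
      pow_zero, pow_one, mul_one, one_mul] at a1 a2 a3 ⊢
    have b2 : M - q * x ^ 2 ≠ 0 := by
      intro h; apply a2; field_simp; linear_combination h
    have b3 : M - q * x ^ 2 * q ≠ 0 := by
      intro h; apply a3; field_simp; linear_combination h
    have e2 : 1 - q * x ^ 2 / M = (M - q * x ^ 2) / M := by field_simp
    have e3 : 1 - q * x ^ 2 / M * q = (M - q * x ^ 2 * q) / M := by field_simp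
    rw [e2, e3]
    obtain ⟨d2, hd2⟩ : ∃ d, d = 1 - q * N * x ^ 2 := ⟨_, rfl⟩
    obtain ⟨d3, hd3⟩ : ∃ d, d = M - q * x ^ 2 := ⟨_, rfl⟩
    obtain ⟨d4, hd4⟩ : ∃ d, d = M - q * x ^ 2 * q := ⟨_, rfl⟩
    rw [← hd2] at a1
    rw [← hd3] at b2
    rw [← hd4] at b3
    rw [← hd2, ← hd3, ← hd4]
    clear a2 a3 e2 e3
    field_simp
    subst hd2 hd3 hd4
    ring
  | succ k ih =>
    rw [Finset.sum_range_succ, ih, key]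
    have a0 := hqq k
    have a1 := hx2 (k+1)
    have a2 := hMx (k+1)
    have a3 := hMx (k+2)
    have c1 : qPoch q q k ≠ 0 := qPoch_ne_zero' _ _ _ hqq
    have c2 : qPoch (q * N * x ^ 2) q (k+1) ≠ 0 := qPoch_ne_zero' _ _ _ hx2
    have c3 : qPoch (q * x ^ 2 / M) q (k+1) ≠ 0 := qPoch_ne_zero' _ _ _ hMx
    rw [dixU, dixG, dixG, qPoch_succ_left (x ^ 2), qPoch_succ_left N⁻¹,
      qPoch_succ_right (q * x ^ 2 / M) q (k + 2), qPoch_succ_right (q * x ^ 2 / M) q (k + 1),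
      qPoch_succ_right (q * N * x ^ 2) q (k + 1), qPoch_succ_right q q k,
      qPoch_succ_right M q (k + 1),
      qPoch_succ_right (q * x ^ 2) q (k + 1), qPoch_succ_right (q * x ^ 2) q k,
      qPoch_succ_right (q * N⁻¹) q k]
    generalize qPoch q q k = A1 at *
    generalize qPoch (q * N * x ^ 2) q (k+1) = A2 at *
    generalize qPoch (q * x ^ 2 / M) q (k+1) = A3 at *
    generalize qPoch (q * x ^ 2) q k = A4 at *
    generalize qPoch (q * N⁻¹) q k = A5 at *
    generalize qPoch M q (k+1) = A6 at *
    simp only [pow_succ] at *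
    clear key ih hqq hnegx hx2 hMx
    have hu : ∃ u, u = (q * N * x / M) ^ k := ⟨_, rfl⟩
    obtain ⟨u, hu⟩ := hu
    rw [← hu]
    clear hu
    generalize q ^ k = Y at *
    have b2 : M - q * x ^ 2 * (Y * q) ≠ 0 := by
      intro h; apply a2; field_simp; linear_combination h
    have b3 : M - q * x ^ 2 * (Y * q * q) ≠ 0 := by
      intro h; apply a3; field_simp; linear_combination h
    have e2 : 1 - q * x ^ 2 / M * (Y * q) = (M - q * x ^ 2 * (Y * q)) / M := by field_simp
    have e3 : 1 - q * x ^ 2 / M * (Y * q * q) = (M - q * x ^ 2 * (Y * q * q)) / M := by field_simp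
    simp only [pow_zero, one_mul, pow_two] at *
    rw [e2, e3]
    obtain ⟨d1, hd1⟩ : ∃ d, d = 1 - q * Y := ⟨_, rfl⟩
    obtain ⟨d2, hd2⟩ : ∃ d, d = 1 - q * N * (x * x) * (Y * q) := ⟨_, rfl⟩
    obtain ⟨d3, hd3⟩ : ∃ d, d = M - q * (x * x) * (Y * q) := ⟨_, rfl⟩
    obtain ⟨d4, hd4⟩ : ∃ d, d = M - q * (x * x) * (Y * q * q) := ⟨_, rfl⟩
    rw [← hd1] at a0
    rw [← hd2] at a1
    rw [← hd3] at b2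
    rw [← hd4] at b3
    rw [← hd1, ← hd2, ← hd3, ← hd4]
    clear a2 a3 e2 e3
    field_simp
    subst hd1 hd2 hd3 hd4
    ring

/-- The identity in terms of `dixT`. -/
lemma dix_main {F : Type*} [Field F] (q M : F) (hq : q ≠ 0) (hM : M ≠ 0)
    (hqq : ∀ j : ℕ, 1 - q * q ^ j ≠ 0) (m : ℕ) : ∀ (x : F)
    (_ : ∀ j : ℕ, 1 + x * q ^ j ≠ 0)
    (_ : ∀ j : ℕ, 1 - q * x * q ^ j ≠ 0)
    (_ : ∀ j : ℕ, 1 - q * q ^ m * x ^ 2 * q ^ j ≠ 0)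
    (_ : ∀ j : ℕ, 1 - q * x ^ 2 / M * q ^ j ≠ 0),
    ∑ k ∈ Finset.range (m + 1), dixT q x M (q ^ m) k
      = qPoch (q * x ^ 2) q m * qPoch (q * x / M) q m /
          (qPoch (q * x) q m * qPoch (q * x ^ 2 / M) q m) := by
  induction m with
  | zero =>
    intro x _ _ _ _
    simp [dixT, qPoch_zero']
  | succ m ih =>
    intro x hnegx hqx hx2 hMx
    have hN : q ^ (m + 1) ≠ 0 := pow_ne_zero _ hq
    have tele := dix_tele q x M (q ^ (m + 1)) hN hM hqq hnegx hx2 hMx (m + 1)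
    have hz : qPoch (q * (q ^ (m + 1))⁻¹) q (m + 1) = 0 := by
      rw [qPoch_succ_right]
      have : q * (q ^ (m + 1))⁻¹ * q ^ m = 1 := by
        rw [pow_succ]; field_simp
      rw [this]; ring
    have hG : dixG q x M (q ^ (m + 1)) (m + 1) = 0 := by
      rw [dixG, hz]; ring
    have hU0 : dixU q x M (q ^ (m + 1)) (m + 1) = 0 := by
      rw [dixU, hz]; ring
    rw [hG, Finset.sum_sub_distrib, sub_eq_zero, Finset.sum_range_succ (dixU q x M (q ^ (m + 1))),
      hU0, add_zero] at tele
    rw [tele]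
    have hnegx' : ∀ j : ℕ, 1 + q * x * q ^ j ≠ 0 := by
      intro j h; apply hnegx (j + 1); rw [pow_succ]; linear_combination h
    have ih' := ih (q * x) hnegx'
      (by intro j h; apply hqx (j + 1); rw [pow_succ]; linear_combination h)
      (by intro j h; apply hx2 (j + 1); rw [pow_succ, pow_succ]; linear_combination h)
      (by intro j h; apply hMx (j + 2); rw [pow_succ, pow_succ]; linear_combination h)
    have p0 : 1 - q * x ≠ 0 := by simpa using hqx 0
    have p1 : 1 + q * x ≠ 0 := by simpa using hnegx' 0
    have p2 : 1 - q * x ^ 2 / M ≠ 0 := by simpa using hMx 0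
    have p3 : 1 - q * (q * x ^ 2 / M) ≠ 0 := by
      intro h; apply hMx 1; linear_combination h
    have p4 : 1 - q * q ^ (m + 1) * x ^ 2 ≠ 0 := by simpa using hx2 0
    have hTU : ∀ k, dixU q x M (q ^ (m + 1)) k =
        (1 - q * x ^ 2) * (1 - q * (q * x ^ 2)) * (1 - q * x / M) *
          (1 - q * q ^ (m + 1) * x ^ 2 / M) /
          ((1 - q * q ^ (m + 1) * x ^ 2) * (1 - q * x) * (1 - q * x ^ 2 / M) *
            (1 - q * (q * x ^ 2 / M))) * dixT q (q * x) M (q ^ m) k := by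
      intro k
      have r1 : qPoch (q * x ^ 2) q (k + 1) = (1 - q * x ^ 2) * qPoch ((q * x) ^ 2) q k := by
        rw [qPoch_succ_left]
        congr 2
        ring
      have r2 : qPoch (-(q * (q * x))) q k
          = qPoch (-(q * x)) q k * (1 + q * x * q ^ k) / (1 + q * x) := by
        rw [eq_div_iff p1, qPoch_neg_ratio]
      have r3 : (q ^ m)⁻¹ = q * (q ^ (m + 1))⁻¹ := by
        rw [pow_succ]; field_simp
      have r4 : qPoch (q * q ^ (m + 1) * x ^ 2) q (k + 1)
          = (1 - q * q ^ (m + 1) * x ^ 2) * qPoch (q * q ^ m * (q * x) ^ 2) q k := by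
        rw [qPoch_succ_left]
        congr 2
        ring
      have r5 : qPoch (q * x ^ 2 / M) q (k + 2)
          = (1 - q * x ^ 2 / M) * (1 - q * (q * x ^ 2 / M)) *
            qPoch (q * (q * x) ^ 2 / M) q k := by
        rw [qPoch_succ_left, qPoch_succ_left, mul_assoc]
        congr 3
        ring
      have r6 : q * q ^ m * (q * x) / M = q * q ^ (m + 1) * x / M := by
        rw [pow_succ]; ring
      have n0 : qPoch q q k ≠ 0 := qPoch_ne_zero' _ _ _ hqq
      have n1 : qPoch (-(q * x)) q k ≠ 0 :=
        qPoch_ne_zero' _ _ _ (by intro j h; apply hnegx' j; linear_combination h)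
      have n2 : qPoch (q * q ^ (m + 1) * x ^ 2) q (k + 1) ≠ 0 := qPoch_ne_zero' _ _ _ hx2
      have n3 : qPoch (q * x ^ 2 / M) q (k + 2) ≠ 0 := qPoch_ne_zero' _ _ _ hMx
      rw [r4] at n2
      rw [r5] at n3
      have n2' := right_ne_zero_of_mul n2
      have n3' := right_ne_zero_of_mul n3
      rw [dixU, dixT, r1, r2, r3, r4, r5, r6]
      have e : 1 - q * (q * x ^ 2) = (1 - q * x) * (1 + q * x) := by ring
      rw [e]
      generalize (q * q ^ (m + 1) * x / M) ^ k = u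
      generalize qPoch q q k = A0 at *
      generalize qPoch (-(q * x)) q k = A1 at *
      generalize qPoch (q * q ^ m * (q * x) ^ 2) q k = A2 at *
      generalize qPoch (q * (q * x) ^ 2 / M) q k = A3 at *
      generalize qPoch (q * (q ^ (m + 1))⁻¹) q k = A4 at *
      generalize qPoch M q k = A5 at *
      generalize qPoch ((q * x) ^ 2) q k = A6 at *
      generalize 1 - q * q ^ (m + 1) * x ^ 2 / M = d5 at *
      generalize 1 - q * q ^ (m + 1) * x ^ 2 = d1 at *
      generalize 1 - q * (q * x ^ 2 / M) = d2 at *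
      generalize 1 - q * x ^ 2 / M = d3 at *
      generalize 1 - q * x / M = d4 at *
      rw [show 1 + x * q * q ^ k = 1 + q * x * q ^ k by ring]
      generalize 1 + q * x * q ^ k = d6
      generalize 1 + q * x = d7 at *
      generalize 1 - q * x = d8 at *
      generalize 1 - q * x ^ 2 = d9 at *
      clear ih' ih tele
      field_simp
    rw [Finset.sum_congr rfl fun k _ => hTU k, ← Finset.mul_sum, ih']
    have s1 : qPoch (q * x ^ 2) q (m + 1) = (1 - q * x ^ 2) * (1 - q * (q * x ^ 2)) *
        qPoch (q * (q * x) ^ 2) q m / (1 - q * q ^ (m + 1) * x ^ 2) := by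
      rw [eq_div_iff p4, show q * q ^ (m + 1) * x ^ 2 = q * x ^ 2 * q ^ (m + 1) by ring,
        ← qPoch_succ_right, qPoch_succ_left, qPoch_succ_left, mul_assoc]
      congr 3
      ring
    have p5 : 1 - q * q ^ (m + 1) * x ^ 2 / M ≠ 0 := by
      intro h; apply hMx (m + 1); linear_combination h
    have s2 : qPoch (q * x ^ 2 / M) q (m + 1) = (1 - q * x ^ 2 / M) *
        (1 - q * (q * x ^ 2 / M)) *
        qPoch (q * (q * x) ^ 2 / M) q m / (1 - q * q ^ (m + 1) * x ^ 2 / M) := by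
      rw [eq_div_iff p5, show q * q ^ (m + 1) * x ^ 2 / M = q * x ^ 2 / M * q ^ (m + 1) by ring,
        ← qPoch_succ_right, qPoch_succ_left, qPoch_succ_left, mul_assoc]
      congr 3
      ring
    have n2 : qPoch (q * (q * x)) q m ≠ 0 := qPoch_ne_zero' _ _ _
      (by intro j h; apply hqx (j + 1); rw [pow_succ]; linear_combination h)
    have n3 : qPoch (q * (q * x) ^ 2 / M) q m ≠ 0 := qPoch_ne_zero' _ _ _
      (by intro j h; apply hMx (j + 2); rw [pow_succ, pow_succ]; linear_combination h)
    rw [s1, s2, qPoch_succ_left (q * x / M), qPoch_succ_left (q * x),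
      show q * (q * x / M) = q * (q * x) / M by ring]
    clear hTU ih' ih tele s1 s2 hU0 hG hz
    generalize qPoch (q * (q * x)) q m = A0 at *
    generalize qPoch (q * (q * x) ^ 2 / M) q m = A1 at *
    generalize qPoch (q * (q * x) ^ 2) q m = A2 at *
    generalize qPoch (q * (q * x) / M) q m = A3 at *
    generalize 1 - q * q ^ (m + 1) * x ^ 2 / M = d5 at *
    generalize 1 - q * q ^ (m + 1) * x ^ 2 = d1 at *
    generalize 1 - q * (q * x ^ 2 / M) = d2 at *
    generalize 1 - q * x ^ 2 / M = d3 at *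
    generalize 1 - q * x / M = d4 at *
    generalize 1 - q * x = d8 at *
    field_simp

/-- Terminating q-Dixon formula:
`∑_{k=0}^m (x^2;q)_k (-qx;q)_k (q^{-m};q)_k (M;q)_k /
   ((q;q)_k (-x;q)_k (q^{1+m}x^2;q)_k (qx^2/M;q)_k) · (q^{1+m}x/M)^k
 = (qx^2;q)_m (qx/M;q)_m / ((qx;q)_m (qx^2/M;q)_m)`. -/
theorem q_dixon_terminating {F : Type*} [Field F] (q x M : F) (m : ℕ)
    (hq : q ≠ 0) (hx : x ≠ 0) (hM : M ≠ 0)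
    (hqq : ∀ j : ℕ, 1 - q ^ (j + 1) ≠ 0)
    (hnegx : ∀ j : ℕ, 1 + x * q ^ j ≠ 0)
    (hqx : ∀ j : ℕ, 1 - q * x * q ^ j ≠ 0)
    (hx2 : ∀ j : ℕ, 1 - q ^ (1 + m) * x ^ 2 * q ^ j ≠ 0)
    (hMx : ∀ j : ℕ, 1 - q * x ^ 2 / M * q ^ j ≠ 0) :
    ∑ k ∈ Finset.range (m + 1),
        (qPoch (x ^ 2) q k * qPoch (-(q * x)) q k * qPoch (q ^ (-(m : ℤ))) q k *
            qPoch M q k) /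
          (qPoch q q k * qPoch (-x) q k * qPoch (q ^ (1 + m) * x ^ 2) q k *
            qPoch (q * x ^ 2 / M) q k) *
          (q ^ (1 + m) * x / M) ^ k
      = qPoch (q * x ^ 2) q m * qPoch (q * x / M) q m /
          (qPoch (q * x) q m * qPoch (q * x ^ 2 / M) q m) := by
  have hqq' : ∀ j : ℕ, 1 - q * q ^ j ≠ 0 := by
    intro j; rw [← pow_succ']; exact hqq j
  have h := dix_main q M hq hM hqq' m x hnegx hqx
    (by intro j; rw [← pow_succ', add_comm]; exact hx2 j) hMx
  rw [← h]
  refine Finset.sum_congr rfl fun k _ => ?_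
  rw [dixT, zpow_neg, zpow_natCast, pow_add, pow_one]
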